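/- arXiv:1910.13095 — 7 statements merged into one kernel-verified Lean document; each statement's English description precedes it below -/
import Mathlib

section
/- In the attraction competition game with n players with positive popularity degrees θ_1, …, θ_n and m time slots with positive demands d_1, …, d_m, there always exists a pure Nash equilibrium, i.e., an action profile a : {1,…,n} → {1,…,m} such that for every player i and every slot j, d_{a_i} · θ_i / (Σ_{k : a_k = a_i} θ_k) ≥ d_j · θ_i / (θ_i + Σ_{k ≠ i : a_k = j} θ_k). -/
open Finset

lemma acg_load {n m : ℕ} (θ : Fin n → ℝ) (a : Fin n → Fin m) (i : Fin n) (j l : Fin m) :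
    ∑ k ∈ univ.filter (fun k => Function.update a i j k = l), θ k =
      (∑ k ∈ univ.filter (fun k => k ≠ i ∧ a k = l), θ k) + if l = j then θ i else 0 := by
  rw [Finset.sum_filter, Finset.sum_filter, ← Finset.add_sum_erase _ _ (mem_univ i),
    ← Finset.add_sum_erase univ (fun k => if k ≠ i ∧ a k = l then θ k else 0) (mem_univ i)]
  have : ∑ k ∈ univ.erase i, (if Function.update a i j k = l then θ k else 0) =
      ∑ k ∈ univ.erase i, (if k ≠ i ∧ a k = l then θ k else 0) := by
    refine Finset.sum_congr rfl fun k hk => ?_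
    have hk : k ≠ i := (Finset.mem_erase.1 hk).1
    simp [hk]
  rw [this]
  simp [eq_comm, add_comm]

lemma acg_pot {n m : ℕ} (θ : Fin n → ℝ) (d : Fin m → ℝ) (a : Fin n → Fin m) (i : Fin n) :
    ∃ c : ℝ, ∀ j : Fin m,
      (∑ l, (∑ k ∈ univ.filter (fun k => Function.update a i j k = l), θ k) ^ 2 / d l)
        + ∑ k, θ k ^ 2 / d (Function.update a i j k) =
      c + 2 * θ i * ((θ i + ∑ k ∈ univ.filter (fun k => k ≠ i ∧ a k = j), θ k) / d j) := by
  refine ⟨(∑ l, (∑ k ∈ univ.filter (fun k => k ≠ i ∧ a k = l), θ k) ^ 2 / d l)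
    + ∑ k ∈ univ.erase i, θ k ^ 2 / d (a k), fun j => ?_⟩
  simp only [acg_load]
  have h1 : ∀ l, ((∑ k ∈ univ.filter (fun k => k ≠ i ∧ a k = l), θ k)
      + if l = j then θ i else 0) ^ 2 / d l =
      (∑ k ∈ univ.filter (fun k => k ≠ i ∧ a k = l), θ k) ^ 2 / d l +
      if l = j then (2 * (∑ k ∈ univ.filter (fun k => k ≠ i ∧ a k = l), θ k) * θ i + θ i ^ 2) / d l
        else 0 := by
    intro l
    split_ifs <;> ring
  have h2 : ∑ k ∈ univ.erase i, θ k ^ 2 / d (Function.update a i j k) =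
      ∑ k ∈ univ.erase i, θ k ^ 2 / d (a k) := by
    refine Finset.sum_congr rfl fun k hk => ?_
    rw [Function.update_of_ne (Finset.mem_erase.1 hk).1]
  rw [Finset.sum_congr rfl fun l _ => h1 l, Finset.sum_add_distrib,
    Finset.sum_ite_eq' univ j, ← Finset.add_sum_erase _ _ (mem_univ i), h2]
  simp only [mem_univ, if_true, Function.update_self]
  ring

/-- In the attraction competition game with `n` players with positive popularity
degrees `θ` and `m > 0` time slots with positive demands `d`, there always exists
a pure Nash equilibrium. -/
theorem attraction_competition_exists_pure_nash_equilibrium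
    (n m : ℕ) (hm : 0 < m) (θ : Fin n → ℝ) (d : Fin m → ℝ)
    (hθ : ∀ i, 0 < θ i) (hd : ∀ j, 0 < d j) :
    ∃ a : Fin n → Fin m, ∀ (i : Fin n) (j : Fin m),
      d j * θ i / (θ i + ∑ k ∈ univ.filter (fun k => k ≠ i ∧ a k = j), θ k) ≤
        d (a i) * θ i / (∑ k ∈ univ.filter (fun k => a k = a i), θ k) := by
  haveI : Nonempty (Fin n → Fin m) := ⟨fun _ => ⟨0, hm⟩⟩
  obtain ⟨a, ha⟩ := Finite.exists_min (fun a : Fin n → Fin m =>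
    (∑ l, (∑ k ∈ univ.filter (fun k => a k = l), θ k) ^ 2 / d l) + ∑ k, θ k ^ 2 / d (a k))
  refine ⟨a, fun i j => ?_⟩
  obtain ⟨c, hc⟩ := acg_pot θ d a i
  have h1 := hc (a i)
  have h2 := ha (Function.update a i j)
  have h3 := acg_load θ a i (a i) (a i)
  simp only [Function.update_eq_self] at h1 h3
  simp only [if_true] at h3
  simp only [hc j, h1] at h2
  rw [h3, add_comm _ (θ i)]
  have hS : ∀ l, 0 ≤ ∑ k ∈ univ.filter (fun k => k ≠ i ∧ a k = l), θ k :=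
    fun l => Finset.sum_nonneg fun k _ => (hθ k).le
  have hi := hθ i
  have h4 := le_of_mul_le_mul_left (le_of_add_le_add_left h2) (by positivity)
  have hj := hS j
  have hai := hS (a i)
  rw [div_le_div_iff₀ (hd _) (hd _)] at h4
  rw [div_le_div_iff₀ (by linarith) (by linarith)]
  nlinarith
end

section
/- Suppose the players of the attraction competition game are indexed so that θ_1 ≥ θ_2 ≥ … ≥ θ_n > 0 and all demands d_j are positive, and suppose the action profile a is produced by the greedy process in which players choose sequentially in this order, each picking a slot that maximizes his utility against the choices already made: that is, for every player i and every slot j, d_{a_i} · θ_i / (θ_i + Σ_{k < i : a_k = a_i} θ_k) ≥ d_j · θ_i / (θ_i + Σ_{k < i : a_k = j} θ_k). Then a is a pure Nash equilibrium of the attraction competition game. -/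
open Finset

/-- If the players of the attraction competition game are indexed so that
`θ 0 ≥ θ 1 ≥ … ≥ θ (n-1) > 0` and the action profile `a` is produced by the
greedy process in which players choose sequentially in this order, each picking
a slot maximizing his utility against the choices already made, then `a` is a
pure Nash equilibrium. -/
theorem attraction_competition_greedy_is_nash_equilibrium
    (n m : ℕ) (θ : Fin n → ℝ) (d : Fin m → ℝ)
    (hθ : ∀ i, 0 < θ i)
    (hmono : ∀ i j : Fin n, i ≤ j → θ j ≤ θ i)
    (hd : ∀ j, 0 < d j) (a : Fin n → Fin m)
    (hgreedy : ∀ (i : Fin n) (j : Fin m),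
      d j * θ i / (θ i + ∑ k ∈ univ.filter (fun k => k < i ∧ a k = j), θ k) ≤
        d (a i) * θ i / (θ i + ∑ k ∈ univ.filter (fun k => k < i ∧ a k = a i), θ k)) :
    ∀ (i : Fin n) (j : Fin m),
      d j * θ i / (θ i + ∑ k ∈ univ.filter (fun k => k ≠ i ∧ a k = j), θ k) ≤
        d (a i) * θ i / (∑ k ∈ univ.filter (fun k => a k = a i), θ k) := by
  intro i j
  by_cases hj : j = a i
  · subst hj
    have h : θ i + ∑ k ∈ univ.filter (fun k => k ≠ i ∧ a k = a i), θ k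
        = ∑ k ∈ univ.filter (fun k => a k = a i), θ k := by
      rw [← Finset.add_sum_erase (univ.filter (fun k => a k = a i)) θ (a := i) (by simp)]
      congr 1
      apply Finset.sum_congr _ (fun _ _ => rfl)
      ext k
      simp
    rw [h]
  · obtain ⟨l, hl, hmax⟩ := Finset.exists_max_image
      (univ.filter (fun k => a k = a i)) id ⟨i, by simp⟩
    have hal : a l = a i := by simpa using hl
    have hil : i ≤ l := hmax i (by simp)
    have hg := hgreedy l j
    rw [hal] at hg
    have h : θ l + ∑ k ∈ univ.filter (fun k => k < l ∧ a k = a i), θ k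
        = ∑ k ∈ univ.filter (fun k => a k = a i), θ k := by
      rw [← Finset.add_sum_erase (univ.filter (fun k => a k = a i)) θ hl]
      congr 1
      apply Finset.sum_congr _ (fun _ _ => rfl)
      ext k
      simp only [mem_filter, mem_univ, true_and, mem_erase]
      constructor
      · rintro ⟨h1, h2⟩
        exact ⟨h1.ne, h2⟩
      · rintro ⟨h1, h2⟩
        exact ⟨lt_of_le_of_ne (hmax k (by simpa using h2)) h1, h2⟩
    rw [h] at hg
    have hS : ∑ k ∈ univ.filter (fun k => k < l ∧ a k = j), θ k
        ≤ ∑ k ∈ univ.filter (fun k => k ≠ i ∧ a k = j), θ k := by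
      apply Finset.sum_le_sum_of_subset_of_nonneg
      · intro k hk
        simp only [mem_filter, mem_univ, true_and] at hk ⊢
        refine ⟨?_, hk.2⟩
        rintro rfl
        exact hj hk.2.symm
      · intro k _ _
        exact (hθ k).le
    have h0 : 0 ≤ ∑ k ∈ univ.filter (fun k => k < l ∧ a k = j), θ k :=
      Finset.sum_nonneg (fun k _ => (hθ k).le)
    have hli := hmono i l hil
    have hlp := hθ l
    rw [mul_div_right_comm, mul_div_right_comm] at hg
    have hg' := le_of_mul_le_mul_right hg hlp
    rw [mul_div_right_comm, mul_div_right_comm]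
    apply mul_le_mul_of_nonneg_right _ (hθ i).le
    refine le_trans ?_ hg'
    apply div_le_div_of_nonneg_left (hd j).le <;> linarith
end

section
/- Suppose all players of the attraction competition game are homogeneous, i.e., θ_i = 1 for every player i, all demands d_j are positive, and there are no ties: for all distinct slots j ≠ l and all integers p, q with 1 ≤ p, q ≤ n, d_j · q ≠ d_l · p. Then the pure Nash equilibrium is unique up to permutations of players: for any two pure Nash equilibria a and a' and every slot j, the number of players choosing slot j is the same, |{k : a_k = j}| = |{k : a'_k = j}|. -/
open Finset

theorem nash_key_aux (n m : ℕ) (d : Fin m → ℝ) (a : Fin n → Fin m)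
    (ha : ∀ (i : Fin n) (j : Fin m),
      d j / (1 + ((univ.filter (fun k => k ≠ i ∧ a k = j)).card : ℝ)) ≤
        d (a i) / ((univ.filter (fun k => a k = a i)).card : ℝ))
    (j l : Fin m) (hjl : j ≠ l) (hl : 0 < (univ.filter (fun k => a k = l)).card) :
    d j * ((univ.filter (fun k => a k = l)).card : ℝ) ≤
      d l * (((univ.filter (fun k => a k = j)).card + 1 : ℕ) : ℝ) := by
  obtain ⟨i, hi⟩ := Finset.card_pos.mp hl
  have hi' : a i = l := by simpa using hi
  have h := ha i j
  have e : (univ.filter (fun k => k ≠ i ∧ a k = j)) = univ.filter (fun k => a k = j) := by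
    ext k
    simp only [mem_filter, mem_univ, true_and, and_iff_right_iff_imp]
    rintro hk rfl
    exact hjl (hk.symm.trans hi')
  rw [e, hi'] at h
  have hl' : (0 : ℝ) < ((univ.filter (fun k => a k = l)).card : ℝ) := by exact_mod_cast hl
  rw [div_le_div_iff₀ (by positivity) hl'] at h
  push_cast
  linarith

theorem nash_le_aux (n m : ℕ) (d : Fin m → ℝ) (hd : ∀ j, 0 < d j)
    (hties : ∀ j l : Fin m, j ≠ l → ∀ p q : ℕ,
      1 ≤ p → p ≤ n → 1 ≤ q → q ≤ n → d j * (q : ℝ) ≠ d l * (p : ℝ))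
    (a a' : Fin n → Fin m)
    (ha : ∀ (i : Fin n) (j : Fin m),
      d j / (1 + ((univ.filter (fun k => k ≠ i ∧ a k = j)).card : ℝ)) ≤
        d (a i) / ((univ.filter (fun k => a k = a i)).card : ℝ))
    (ha' : ∀ (i : Fin n) (j : Fin m),
      d j / (1 + ((univ.filter (fun k => k ≠ i ∧ a' k = j)).card : ℝ)) ≤
        d (a' i) / ((univ.filter (fun k => a' k = a' i)).card : ℝ)) (j : Fin m) :
    (univ.filter (fun k => a' k = j)).card ≤ (univ.filter (fun k => a k = j)).card := by
  by_contra! hj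
  have hs : ∀ b : Fin n → Fin m, ∑ l, (univ.filter (fun k => b k = l)).card = n := by
    intro b
    have := Finset.card_eq_sum_card_fiberwise (f := b) (s := univ) (t := univ) (by simp)
    simpa using this.symm
  have hn : ∀ (b : Fin n → Fin m) l, (univ.filter (fun k => b k = l)).card ≤ n := by
    intro b l
    simpa using Finset.card_filter_le (univ : Finset (Fin n)) (fun k => b k = l)
  obtain ⟨l, hl⟩ : ∃ l, (univ.filter (fun k => a' k = l)).card <
      (univ.filter (fun k => a k = l)).card := by
    by_contra! hc
    have := Finset.sum_lt_sum (fun l (_ : l ∈ univ) => hc l) ⟨j, mem_univ j, hj⟩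
    rw [hs, hs] at this
    exact lt_irrefl _ this
  have hjl : j ≠ l := by rintro rfl; omega
  have h1 := nash_key_aux n m d a ha j l hjl (by omega)
  have h2 := nash_key_aux n m d a' ha' l j hjl.symm (by omega)
  have h3 := mul_le_mul_of_nonneg_left (Nat.cast_le (α := ℝ).mpr (Nat.succ_le_of_lt hj)) (hd l).le
  have h4 := mul_le_mul_of_nonneg_left (Nat.cast_le (α := ℝ).mpr (Nat.succ_le_of_lt hl)) (hd j).le
  exact hties j l hjl _ _ (by omega) (hn a' j) (by omega) (hn a l)
    (le_antisymm (h1.trans h3) (h2.trans h4))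

/-- For homogeneous players (all popularity degrees equal to 1) with positive
demands and no ties (`d j * q ≠ d l * p` for distinct slots `j ≠ l` and
`1 ≤ p, q ≤ n`), the pure Nash equilibrium is unique up to permutations of
players: any two pure Nash equilibria have the same number of players in each
slot. -/
theorem attraction_competition_homogeneous_unique_nash_equilibrium
    (n m : ℕ) (d : Fin m → ℝ) (hd : ∀ j, 0 < d j)
    (hties : ∀ j l : Fin m, j ≠ l → ∀ p q : ℕ,
      1 ≤ p → p ≤ n → 1 ≤ q → q ≤ n → d j * (q : ℝ) ≠ d l * (p : ℝ))
    (a a' : Fin n → Fin m)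
    (ha : ∀ (i : Fin n) (j : Fin m),
      d j / (1 + ((univ.filter (fun k => k ≠ i ∧ a k = j)).card : ℝ)) ≤
        d (a i) / ((univ.filter (fun k => a k = a i)).card : ℝ))
    (ha' : ∀ (i : Fin n) (j : Fin m),
      d j / (1 + ((univ.filter (fun k => k ≠ i ∧ a' k = j)).card : ℝ)) ≤
        d (a' i) / ((univ.filter (fun k => a' k = a' i)).card : ℝ)) :
    ∀ j : Fin m,
      (univ.filter (fun k => a k = j)).card = (univ.filter (fun k => a' k = j)).card := by
  exact fun j => le_antisymm (nash_le_aux n m d hd hties a' a ha' ha j)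
    (nash_le_aux n m d hd hties a a' ha ha' j)
end

section
/- Suppose all players of the attraction competition game are homogeneous (θ_i = 1 for all i), all demands d_j are positive, and a is a pure Nash equilibrium with slot occupancies c_j = |{k : a_k = j}|. Then all the utility-density intervals intersect: there exists a real number r > 0 such that for every slot j, d_j / (c_j + 1) ≤ r, and moreover r ≤ d_j / c_j for every slot j with c_j ≥ 1. -/
open Finset

/-- For homogeneous players (all popularity degrees equal to 1) with positive
demands, in a pure Nash equilibrium `a` with slot occupancies
`c j = |{k : a k = j}|`, all utility-density intervals `(d j/(c j + 1), d j/c j]`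
intersect: there exists `r > 0` with `d j / (c j + 1) ≤ r` for every slot `j`,
and `r ≤ d j / c j` for every slot `j` with `c j ≥ 1`. -/
theorem attraction_competition_homogeneous_intervals_overlap
    (n m : ℕ) (d : Fin m → ℝ) (hd : ∀ j, 0 < d j) (a : Fin n → Fin m)
    (hNE : ∀ (i : Fin n) (j : Fin m),
      d j / (1 + ((univ.filter (fun k => k ≠ i ∧ a k = j)).card : ℝ)) ≤
        d (a i) / ((univ.filter (fun k => a k = a i)).card : ℝ)) :
    ∃ r : ℝ, 0 < r ∧
      (∀ j : Fin m, d j / (((univ.filter (fun k => a k = j)).card : ℝ) + 1) ≤ r) ∧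
      (∀ j : Fin m, 1 ≤ (univ.filter (fun k => a k = j)).card →
        r ≤ d j / ((univ.filter (fun k => a k = j)).card : ℝ)) := by
  rcases isEmpty_or_nonempty (Fin m) with hm | hm
  · exact ⟨1, one_pos, fun j => hm.elim j, fun j => hm.elim j⟩
  obtain ⟨j0, hj0⟩ := Finite.exists_max
    (fun j : Fin m => d j / (((univ.filter (fun k => a k = j)).card : ℝ) + 1))
  refine ⟨_, ?_, hj0, ?_⟩
  · have := hd j0
    positivity
  · intro j hj
    obtain ⟨i, hi⟩ := Finset.card_pos.mp hj
    have hi2 : a i = j := by simpa using hi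
    subst hi2
    refine le_trans ?_ (hNE i j0)
    have hc : ((univ.filter (fun k => k ≠ i ∧ a k = j0)).card : ℝ) ≤
        ((univ.filter (fun k => a k = j0)).card : ℝ) := by
      exact_mod_cast Finset.card_le_card (fun k hk => by
        simp only [mem_filter, mem_univ, true_and] at hk ⊢
        exact hk.2)
    apply div_le_div_of_nonneg_left (hd j0).le (by positivity)
    linarith
end

section
/- Let r_1, …, r_k be positive integers with sum S, and define f(t) = t/(1+t) + (S−t)/(1+S−t) for real t ∈ [0, S]. Then there exists a subset I ⊆ {1,…,k} with 2 · Σ_{i∈I} r_i = S (i.e., the multiset {r_1,…,r_k} admits a partition into two parts of equal sums) if and only if there exists a subset I ⊆ {1,…,k} with f(Σ_{i∈I} r_i) ≥ 2S/(2+S). (This equivalence is the reduction from the NP-hard Partition problem showing that computing a player's best response in the multi-movie attraction competition game is NP-hard.) -/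
open Finset

/-- Reduction from Partition: for positive integers `r 1, …, r k` with sum `S`
and `f(t) = t/(1+t) + (S−t)/(1+S−t)`, the multiset `{r 1, …, r k}` admits a
partition into two parts of equal sums iff some subset `I` satisfies
`f(Σ_{i ∈ I} r i) ≥ 2S/(2+S)`. -/
theorem partition_iff_best_response
    (k : ℕ) (r : Fin k → ℕ) (hr : ∀ i, 0 < r i) (S : ℕ) (hS : S = ∑ i, r i) :
    (∃ I : Finset (Fin k), 2 * ∑ i ∈ I, r i = S) ↔
    (∃ I : Finset (Fin k),
      2 * (S : ℝ) / (2 + (S : ℝ)) ≤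
        (∑ i ∈ I, (r i : ℝ)) / (1 + ∑ i ∈ I, (r i : ℝ)) +
          ((S : ℝ) - ∑ i ∈ I, (r i : ℝ)) /
            (1 + (S : ℝ) - ∑ i ∈ I, (r i : ℝ))) := by
  refine exists_congr fun I => ?_
  have hle : ∑ i ∈ I, r i ≤ S := by
    rw [hS]
    exact Finset.sum_le_sum_of_subset (Finset.subset_univ I)
  rw [← Nat.cast_sum]
  generalize ∑ i ∈ I, r i = t at hle ⊢
  have h0 : (0 : ℝ) ≤ t := Nat.cast_nonneg t
  have h1 : (t : ℝ) ≤ S := by exact_mod_cast hle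
  have a1 : (0 : ℝ) < 2 + S := by linarith
  have a2 : (0 : ℝ) < 1 + t := by linarith
  have a3 : (0 : ℝ) < 1 + S - t := by linarith
  have key : (t : ℝ) / (1 + t) + ((S : ℝ) - t) / (1 + S - t) - 2 * S / (2 + S)
      = -(((S : ℝ) - 2 * t) ^ 2 / ((2 + S) * (1 + t) * (1 + S - t))) := by
    have b1 := a1.ne'
    have b2 := a2.ne'
    have b3 := a3.ne'
    field_simp
    ring
  have hd : (0 : ℝ) < (2 + S) * (1 + t) * (1 + S - t) := by positivity
  constructor
  · intro h
    have h2 : (S : ℝ) - 2 * t = 0 := by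
      rw [← h]
      push_cast
      ring
    rw [h2] at key
    norm_num at key
    linarith
  · intro h
    have h3 : ((S : ℝ) - 2 * t) ^ 2 / ((2 + S) * (1 + t) * (1 + S - t)) ≤ 0 := by linarith
    have h4 : ((S : ℝ) - 2 * t) ^ 2 ≤ 0 := by
      by_contra hc
      push Not at hc
      exact absurd (div_pos hc hd) (not_lt.mpr h3)
    have h5 : (S : ℝ) - 2 * t = 0 := by
      exact pow_eq_zero_iff (two_ne_zero) |>.mp (le_antisymm h4 (sq_nonneg _))
    have h6 : (2 * t : ℝ) = S := by linarith
    exact_mod_cast h6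
end

section
/- Consider the two-week attraction competition game with homogeneous players (θ_i = 1 for all i): there are m time slots with demands d_1, …, d_m > 0, each player chooses a release slot a_i ∈ {1,…,m}, and with c_j(a) = |{k : a_k = j}| (and the conventions c_0(a) = 0, c_{m+1}(a) = 0, d_{m+1} = 0), player i's utility is u*_i(a) = d_{a_i} / (c_{a_i}(a) + c_{a_i − 1}(a)) + d_{a_i + 1} / (c_{a_i + 1}(a) + c_{a_i}(a)). Define φ(a) = Σ_{j=1}^{m+1} Σ_{k=1}^{c_j(a)+c_{j−1}(a)} d_j / k. Then φ is an exact potential: for every player i, profile a, and alternative slot a'_i, letting a' = (a'_i, a_{−i}), we have u*_i(a) − u*_i(a') = φ(a) − φ(a'). -/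
open Finset

/-- Occupancy of slot `j ∈ {1, …, m}` (as a natural number) under the profile
`a`; by convention `occ a 0 = 0` and `occ a (m+1) = 0` automatically hold when
all players play slots in `{1, …, m}`. -/
def occ {n : ℕ} (a : Fin n → ℕ) (j : ℕ) : ℕ :=
  (univ.filter (fun k => a k = j)).card

/-- Player `i`'s utility in the two-week attraction competition game with
homogeneous players: a movie released at slot `j` gets `d j` shared with all
movies released at slots `j` or `j - 1`, plus `d (j+1)` shared with all movies
released at slots `j + 1` or `j`. -/
noncomputable def twoWeekUtil {n : ℕ} (d : ℕ → ℝ) (a : Fin n → ℕ) (i : Fin n) : ℝ :=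
  d (a i) / ((occ a (a i) : ℝ) + (occ a (a i - 1) : ℝ)) +
    d (a i + 1) / ((occ a (a i + 1) : ℝ) + (occ a (a i) : ℝ))

/-- The potential function `φ(a) = Σ_{j=1}^{m+1} Σ_{k=1}^{c_j(a)+c_{j-1}(a)} d j / k`. -/
noncomputable def twoWeekPotential {n : ℕ} (m : ℕ) (d : ℕ → ℝ) (a : Fin n → ℕ) : ℝ :=
  ∑ j ∈ Finset.Icc 1 (m + 1),
    ∑ k ∈ Finset.range (occ a j + occ a (j - 1)), d j / ((k : ℝ) + 1)

/-- Occupancy by the players other than `i`. -/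
def occOff {n : ℕ} (a : Fin n → ℕ) (i : Fin n) (j : ℕ) : ℕ :=
  ((univ.erase i).filter (fun k => a k = j)).card

lemma occ_eq_occOff {n : ℕ} (a : Fin n → ℕ) (i : Fin n) (j : ℕ) :
    occ a j = occOff a i j + if a i = j then 1 else 0 := by
  unfold occ occOff
  rw [Finset.card_filter, Finset.card_filter,
    Finset.sum_erase_add _ _ (Finset.mem_univ i)]

lemma occOff_update {n : ℕ} (a : Fin n → ℕ) (i : Fin n) (x j : ℕ) :
    occOff (Function.update a i x) i j = occOff a i j := by
  unfold occOff
  congr 1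
  apply Finset.filter_congr
  intro k hk
  rw [Function.update_of_ne (Finset.ne_of_mem_erase hk)]

lemma twoWeekPotential_eq {n m : ℕ} (d : ℕ → ℝ) (a : Fin n → ℕ) (i : Fin n)
    (h1 : 1 ≤ a i) (h2 : a i ≤ m) :
    twoWeekPotential m d a = (∑ j ∈ Finset.Icc 1 (m + 1),
      ∑ k ∈ Finset.range (occOff a i j + occOff a i (j - 1)), d j / ((k : ℝ) + 1)) +
      twoWeekUtil d a i := by
  have key : ∀ j ∈ Finset.Icc 1 (m + 1),
      ∑ k ∈ Finset.range (occ a j + occ a (j - 1)), d j / ((k : ℝ) + 1) =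
      ∑ k ∈ Finset.range (occOff a i j + occOff a i (j - 1)), d j / ((k : ℝ) + 1) +
      ((if j = a i then d (a i) / ((occ a (a i) : ℝ) + (occ a (a i - 1) : ℝ)) else 0) +
      (if j = a i + 1 then
        d (a i + 1) / ((occ a (a i + 1) : ℝ) + (occ a (a i) : ℝ)) else 0)) := by
    intro j hj
    have hj1 := (Finset.mem_Icc.mp hj).1
    by_cases e1 : j = a i
    · subst e1
      have e2 : a i ≠ a i - 1 := by omega
      simp only [occ_eq_occOff a i, if_neg e2, if_true]
      rw [show occOff a i (a i) + 1 + (occOff a i (a i - 1) + 0)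
        = (occOff a i (a i) + occOff a i (a i - 1)) + 1 by ring, Finset.sum_range_succ]
      simp
      ring
    · by_cases e2 : j = a i + 1
      · subst e2
        simp only [occ_eq_occOff a i, Nat.add_sub_cancel, if_true, if_neg e1,
          if_neg (Ne.symm e1)]
        rw [show occOff a i (a i + 1) + 0 + (occOff a i (a i) + 1)
          = (occOff a i (a i + 1) + occOff a i (a i)) + 1 by ring, Finset.sum_range_succ]
        simp
        ring
      · have e3 : a i ≠ j - 1 := by omega
        rw [occ_eq_occOff a i, occ_eq_occOff a i, if_neg (Ne.symm e1), if_neg e3,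
          if_neg e1, if_neg e2]
        simp
  unfold twoWeekPotential twoWeekUtil
  rw [Finset.sum_congr rfl key, Finset.sum_add_distrib, Finset.sum_add_distrib,
    Finset.sum_ite_eq', Finset.sum_ite_eq', if_pos (Finset.mem_Icc.mpr ⟨h1, by omega⟩),
    if_pos (Finset.mem_Icc.mpr ⟨by omega, by omega⟩)]

/-- In the two-week attraction competition game with homogeneous players
(all popularity degrees equal to 1), positive demands `d 1, …, d m` and the
convention `d (m+1) = 0`, the function `twoWeekPotential` is an exact
potential: a unilateral deviation of player `i` changes his utility by exactly
the change of the potential. -/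
theorem two_week_exact_potential
    (n m : ℕ) (d : ℕ → ℝ) (hd : ∀ j, 1 ≤ j → j ≤ m → 0 < d j)
    (hdtop : d (m + 1) = 0)
    (a : Fin n → ℕ) (ha : ∀ i, 1 ≤ a i ∧ a i ≤ m)
    (i : Fin n) (ai' : ℕ) (hai'1 : 1 ≤ ai') (hai'2 : ai' ≤ m) :
    twoWeekUtil d a i - twoWeekUtil d (Function.update a i ai') i =
      twoWeekPotential m d a - twoWeekPotential m d (Function.update a i ai') := by
  have hu : Function.update a i ai' i = ai' := Function.update_self ..
  rw [twoWeekPotential_eq d a i (ha i).1 (ha i).2,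
    twoWeekPotential_eq d (Function.update a i ai') i (by rw [hu]; exact hai'1)
      (by rw [hu]; exact hai'2)]
  simp only [occOff_update]
  ring
end

section
/- Consider the two-week attraction competition game with homogeneous players (θ_i = 1 for all i): there are m time slots with demands d_1, …, d_m > 0, each player chooses a release slot a_i ∈ {1,…,m}, and with c_j(a) = |{k : a_k = j}| (and the conventions c_0(a) = 0, c_{m+1}(a) = 0, d_{m+1} = 0), player i's utility is u*_i(a) = d_{a_i} / (c_{a_i}(a) + c_{a_i − 1}(a)) + d_{a_i + 1} / (c_{a_i + 1}(a) + c_{a_i}(a)). Then this game always has a pure Nash equilibrium: there exists a profile a such that for every player i and every slot j, u*_i(a) is at least the utility player i would obtain by unilaterally switching to slot j. -/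
open Finset

/-- load of slot `r` counted over players in `s` -/
def ldc {n : ℕ} (s : Finset (Fin n)) (a : Fin n → ℕ) (r : ℕ) : ℕ :=
  (s.filter (fun k => a k = r ∨ a k + 1 = r)).card

noncomputable def hrm (k : ℕ) : ℝ := ∑ t ∈ range k, 1 / ((t : ℝ) + 1)

noncomputable def potl {n : ℕ} (m : ℕ) (d : ℕ → ℝ) (s : Finset (Fin n)) (a : Fin n → ℕ) : ℝ :=
  ∑ r ∈ range (m + 2), d r * hrm (ldc s a r)

lemma ldc_eq {n : ℕ} (a : Fin n → ℕ) (r : ℕ) (hr : 1 ≤ r) :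
    ldc univ a r = occ a r + occ a (r - 1) := by
  unfold ldc occ
  rw [← card_union_of_disjoint]
  · congr 1
    ext k
    simp only [mem_filter, mem_union, mem_univ, true_and]
    omega
  · rw [disjoint_filter]
    intro k _ h1 h2
    omega

lemma ldc_erase {n : ℕ} (a : Fin n → ℕ) (i : Fin n) (r : ℕ) :
    ldc univ a r = ldc (univ.erase i) a r + if a i = r ∨ a i + 1 = r then 1 else 0 := by
  unfold ldc
  conv_lhs => rw [← insert_erase (mem_univ i)]
  rw [filter_insert]
  split_ifs with h
  · rw [card_insert_of_notMem (by simp)]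
  · rfl

lemma potl_eq {n : ℕ} (m : ℕ) (d : ℕ → ℝ) (a : Fin n → ℕ) (i : Fin n)
    (h1 : 1 ≤ a i) (h2 : a i ≤ m) :
    potl m d univ a = potl m d (univ.erase i) a + twoWeekUtil d a i := by
  have key : ∀ r, d r * hrm (ldc univ a r) = d r * hrm (ldc (univ.erase i) a r)
      + ((if a i = r then d r / (ldc univ a r : ℝ) else 0)
        + (if a i + 1 = r then d r / (ldc univ a r : ℝ) else 0)) := by
    intro r
    have e := ldc_erase a i r
    by_cases c1 : a i = r
    · have c2 : ¬ (a i + 1 = r) := by omega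
      simp only [c1, true_or, if_true] at e
      rw [if_pos c1, if_neg c2, e]
      simp only [hrm, sum_range_succ]
      push_cast
      ring
    · by_cases c2 : a i + 1 = r
      · simp only [c2, or_true, if_true] at e
        rw [if_neg c1, if_pos c2, e]
        simp only [hrm, sum_range_succ]
        push_cast
        ring
      · simp only [c1, c2, or_false, if_false] at e
        rw [if_neg c1, if_neg c2, e]
        simp
  unfold potl
  rw [sum_congr rfl (fun r _ => key r), sum_add_distrib, sum_add_distrib, sum_ite_eq, sum_ite_eq,
    if_pos (by simp; omega), if_pos (by simp; omega), ldc_eq a _ h1, ldc_eq a (a i + 1) (by omega)]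
  simp [twoWeekUtil]

/-- The two-week attraction competition game with homogeneous players (all
popularity degrees equal to 1), positive demands `d 1, …, d m` and the
convention `d (m+1) = 0`, always has a pure Nash equilibrium: a profile `a`
with values in `{1, …, m}` such that no player can strictly increase his
utility by unilaterally switching to another slot `j ∈ {1, …, m}`. -/
theorem two_week_exists_pure_nash_equilibrium
    (n m : ℕ) (hm : 1 ≤ m) (d : ℕ → ℝ) (hd : ∀ j, 1 ≤ j → j ≤ m → 0 < d j)
    (hdtop : d (m + 1) = 0) :
    ∃ a : Fin n → ℕ, (∀ i, 1 ≤ a i ∧ a i ≤ m) ∧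
      ∀ (i : Fin n) (j : ℕ), 1 ≤ j → j ≤ m →
        twoWeekUtil d (Function.update a i j) i ≤ twoWeekUtil d a i := by
  obtain ⟨a, ha, hmax⟩ := (Fintype.piFinset (fun _ : Fin n => Icc 1 m)).exists_max_image
    (potl m d univ) ⟨fun _ => 1, by simp [hm]⟩
  have ha' : ∀ i, 1 ≤ a i ∧ a i ≤ m := by simpa using ha
  refine ⟨a, ha', fun i j hj1 hj2 => ?_⟩
  have hb : Function.update a i j ∈ Fintype.piFinset (fun _ : Fin n => Icc 1 m) := by
    rw [Fintype.mem_piFinset]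
    intro k
    by_cases hk : k = i
    · subst hk; simp [hj1, hj2]
    · simpa [hk] using ha' k
  have hle := hmax _ hb
  rw [potl_eq m d a i (ha' i).1 (ha' i).2,
    potl_eq m d (Function.update a i j) i (by simpa using hj1) (by simpa using hj2)] at hle
  have hbase : potl m d (univ.erase i) (Function.update a i j) = potl m d (univ.erase i) a := by
    unfold potl ldc
    refine sum_congr rfl fun r _ => ?_
    congr 3
    refine filter_congr fun k hk => ?_
    rw [Function.update_of_ne (ne_of_mem_erase hk)]
  linarith
end
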